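/- For every h ∈ ℝ and every finite list h̄_1, …, h̄_k ∈ ℝ, the pushforward of P^n_{θ0+h/n} under the map y ↦ (Z_n(h,h̄_1)(y), …, Z_n(h,h̄_k)(y)) converges weakly, as n → ∞, to the law of the random vector (e^{(h̄_1−h)/λ}·𝟙{W > h̄_1}, …, e^{(h̄_k−h)/λ}·𝟙{W > h̄_k}), where W is a real random variable with Lebesgue density w ↦ λ^{-1}·e^{−(w−h)/λ}·𝟙{w > h}. -/

import Mathlib

open MeasureTheory Filter Real Topology

noncomputable section

attribute [local instance] Classical.propDecidable

/-- The benchmark nonregular model of Shimizu–Otsu, satisfying Assumption 1.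
`f y θ` denotes the density kernel `f(y|θ)` and the data density is
`y ↦ f(y|θ) · 𝟙{y ≥ g θ}`. -/
structure BenchmarkModel where
  θ0 : ℝ
  /-- density kernel, `f y θ = f(y|θ)` -/
  f : ℝ → ℝ → ℝ
  /-- boundary function -/
  g : ℝ → ℝ
  /-- open neighborhood of `θ0` -/
  N : Set ℝ
  /-- uniform bound on `f` over `N` -/
  C : ℝ
  N_open : IsOpen N
  θ0_mem : θ0 ∈ N
  /-- (a) `y ↦ f(y|θ)·𝟙{y ≥ g θ}` is a probability density for every `θ`. -/
  f_nonneg : ∀ θ y, g θ ≤ y → 0 ≤ f y θ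
  f_integrable : ∀ θ, IntegrableOn (fun y => f y θ) (Set.Ici (g θ))
  f_density : ∀ θ, ∫ y in Set.Ici (g θ), f y θ = 1
  /-- (b) `θ ↦ f(y|θ)` is twice continuously differentiable for every `y`. -/
  f_smooth : ∀ y, ContDiff ℝ 2 fun θ => f y θ
  /-- (c) continuity in `y` for `θ ∈ N`, and uniform positive bounds on `N` -/
  f_cont : ∀ θ ∈ N, Continuous fun y => f y θ
  fθ_cont : ∀ θ ∈ N, Continuous fun y => deriv (fun t => f y t) θ
  f_pos : ∀ θ ∈ N, ∀ y, 0 < f y θ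
  f_lt : ∀ θ ∈ N, ∀ y, f y θ < C
  /-- (d) integrability of the suprema over `N` -/
  int1 : ∫⁻ y : ℝ, ⨆ θ ∈ N,
      ENNReal.ofReal (|deriv (fun t => f y t) θ| * if g θ ≤ y then 1 else 0) < ⊤
  int2 : ∫⁻ y : ℝ, ⨆ θ ∈ N, ⨆ θ' ∈ N, ENNReal.ofReal
      ((deriv (fun t => f y t) θ') ^ 2 / (f y θ') ^ 2 *
        (if g θ ≤ y then 1 else 0) * f y θ) < ⊤
  int3 : ∫⁻ y : ℝ, ⨆ θ ∈ N, ⨆ θ' ∈ N, ENNReal.ofReal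
      (|deriv (deriv fun t => f y t) θ'| / f y θ' *
        (if g θ ≤ y then 1 else 0) * f y θ) < ⊤
  /-- (e) conditions on `g` -/
  g_smooth : ContDiff ℝ 1 g
  g_deriv_pos : 0 < deriv g θ0
  g_deriv_bdd : ∃ B, ∀ θ ∈ N, |deriv g θ| ≤ B

namespace BenchmarkModel

variable (M : BenchmarkModel)

/-- `λ = (f(g(θ0)|θ0)·g'(θ0))⁻¹`. -/
def lam : ℝ := (M.f (M.g M.θ0) M.θ0 * deriv M.g M.θ0)⁻¹

/-- The joint measure `P_θ^n` of an iid sample of size `n` on `ℝ^n`. -/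
def P (n : ℕ) (θ : ℝ) : Measure (Fin n → ℝ) :=
  (volume : Measure (Fin n → ℝ)).withDensity fun y =>
    ENNReal.ofReal (∏ i, M.f (y i) θ * if M.g θ ≤ y i then 1 else 0)

/-- The likelihood-ratio statistic `Z_n(h, h̄)`. -/
def Z (n : ℕ) (h hb : ℝ) : (Fin n → ℝ) → ℝ := fun y =>
  if ∀ i, M.g (M.θ0 + h / n) ≤ y i then
    (if ∀ i, M.g (M.θ0 + hb / n) ≤ y i then 1 else 0) *
      ∏ i, M.f (y i) (M.θ0 + hb / n) / M.f (y i) (M.θ0 + h / n)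
  else 0

end BenchmarkModel

namespace BenchmarkModel

/-- The integrand of the domination condition `int2`. -/
def scoreEnvelope (M : BenchmarkModel) (y : ℝ) : ENNReal :=
  ⨆ θ ∈ M.N, ⨆ θ' ∈ M.N, ENNReal.ofReal
      ((deriv (fun t => M.f y t) θ') ^ 2 / (M.f y θ') ^ 2 *
        (if M.g θ ≤ y then 1 else 0) * M.f y θ)

lemma ofReal_score_le (M : BenchmarkModel) {y θ θ' : ℝ} (hθ : θ ∈ M.N) (hθ' : θ' ∈ M.N)
    (hy : M.g θ ≤ y) :
    ENNReal.ofReal ((deriv (fun t => M.f y t) θ') ^ 2 / (M.f y θ') ^ 2 * M.f y θ)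
      ≤ M.scoreEnvelope y := by
  have key : ENNReal.ofReal ((deriv (fun t => M.f y t) θ') ^ 2 / (M.f y θ') ^ 2 *
        (if M.g θ ≤ y then 1 else 0) * M.f y θ) ≤ M.scoreEnvelope y :=
    le_iSup₂_of_le θ hθ (le_iSup₂_of_le θ' hθ' le_rfl)
  simpa [hy] using key

lemma C_pos (M : BenchmarkModel) : 0 < M.C :=
  (M.f_pos _ M.θ0_mem 0).trans (M.f_lt _ M.θ0_mem 0)

/-- Uniform control of the Fisher-information integrand in a window of parameters. -/
lemma exists_ofReal_fisher_le (M : BenchmarkModel) {a b : ℝ} (hab : Set.Icc a b ⊆ M.N) :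
    ∃ K : ℝ, 0 < K ∧ ∀ t ∈ Set.Icc a b, ∀ y, M.g a ≤ y → M.g t ≤ M.g b →
      ENNReal.ofReal ((deriv (fun t => M.f y t) t) ^ 2 / M.f y t)
        ≤ ENNReal.ofReal K * M.scoreEnvelope y := by
  rcases lt_or_ge b a with hba | hba
  · exact ⟨1, one_pos, fun t ht => absurd (ht.1.trans ht.2) hba.not_ge⟩
  have ha : a ∈ M.N := hab ⟨le_rfl, hba⟩
  obtain ⟨m, hm, hmf⟩ : ∃ m : ℝ, 0 < m ∧ ∀ y ∈ Set.Icc (M.g a) (M.g b), m ≤ M.f y a := by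
    rcases (Set.Icc (M.g a) (M.g b)).eq_empty_or_nonempty with he | hne
    · exact ⟨1, one_pos, by simp [he]⟩
    · obtain ⟨x, -, hx⟩ := isCompact_Icc.exists_isMinOn hne (M.f_cont a ha).continuousOn
      exact ⟨M.f x a, M.f_pos a ha x, fun y hy => hx hy⟩
  refine ⟨1 + M.C / m, by have := M.C_pos; positivity, fun t ht y hay htb => ?_⟩
  have htN := hab ht
  have hft := M.f_pos t htN y
  have hCm : 0 < M.C / m := div_pos M.C_pos hm
  set D := deriv (fun t => M.f y t) t with hD
  rcases le_or_gt (M.g t) y with hty | hty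
  · have h1 := M.ofReal_score_le htN htN hty
    have h2 : D ^ 2 / M.f y t ^ 2 * M.f y t = D ^ 2 / M.f y t := by field_simp
    rw [h2] at h1
    calc _ ≤ M.scoreEnvelope y := h1
      _ = 1 * M.scoreEnvelope y := (one_mul _).symm
      _ ≤ _ := by
        gcongr
        rw [← ENNReal.ofReal_one]
        exact ENNReal.ofReal_le_ofReal (by linarith)
  · have h1 := M.ofReal_score_le ha htN hay
    have hmy := hmf y ⟨hay, hty.le.trans htb⟩
    have hC := M.f_lt t htN y
    calc ENNReal.ofReal (D ^ 2 / M.f y t)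
        ≤ ENNReal.ofReal ((1 + M.C / m) * (D ^ 2 / M.f y t ^ 2 * M.f y a)) := by
          apply ENNReal.ofReal_le_ofReal
          have e : D ^ 2 / M.f y t = M.f y t * (D ^ 2 / M.f y t ^ 2) := by field_simp
          have h3 : M.f y t ≤ M.C / m * M.f y a := by
            rw [div_mul_eq_mul_div, le_div_iff₀ hm]
            have := M.f_pos a ha y
            have := M.C_pos
            nlinarith
          have h4 : 0 ≤ D ^ 2 / M.f y t ^ 2 := by positivity
          have := M.f_pos a ha y
          rw [e]
          nlinarith [mul_le_mul_of_nonneg_right h3 h4, mul_nonneg this.le h4]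
      _ = ENNReal.ofReal (1 + M.C / m) *
            ENNReal.ofReal (D ^ 2 / M.f y t ^ 2 * M.f y a) :=
          ENNReal.ofReal_mul (by positivity)
      _ ≤ _ := by gcongr

lemma sq_sqrt_sub_sqrt_le (M : BenchmarkModel) {a b : ℝ} (hab : Set.Icc a b ⊆ M.N) {B y : ℝ}
    (hB : ∀ t ∈ Set.Icc a b, (deriv (fun t => M.f y t) t) ^ 2 / M.f y t ≤ B)
    {s t : ℝ} (hs : s ∈ Set.Icc a b) (ht : t ∈ Set.Icc a b) :
    (√(M.f y s) - √(M.f y t)) ^ 2 ≤ (s - t) ^ 2 * B := by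
  have hderiv : ∀ x ∈ Set.Icc a b, HasDerivWithinAt (fun t => √(M.f y t))
      (deriv (fun t => M.f y t) x / (2 * √(M.f y x))) (Set.Icc a b) x := fun x hx =>
    ((((M.f_smooth y).differentiable (by norm_num)) x).hasDerivAt.sqrt
      (M.f_pos x (hab hx) y).ne').hasDerivWithinAt
  have hbound : ∀ x ∈ Set.Icc a b,
      ‖deriv (fun t => M.f y t) x / (2 * √(M.f y x))‖ ≤ √B := by
    intro x hx
    rw [Real.norm_eq_abs]
    apply Real.abs_le_sqrt
    have hf := M.f_pos x (hab hx) y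
    have := hB x hx
    rw [div_pow, mul_pow, Real.sq_sqrt hf.le]
    have h0 : 0 ≤ (deriv (fun t => M.f y t) x) ^ 2 / M.f y x := by positivity
    have e : (deriv (fun t => M.f y t) x) ^ 2 / (2 ^ 2 * M.f y x) =
      (1 / 4) * ((deriv (fun t => M.f y t) x) ^ 2 / M.f y x) := by field_simp; norm_num
    rw [e]
    linarith
  have hB0 : 0 ≤ B := le_trans (by have := M.f_pos s (hab hs) y; positivity) (hB s hs)
  have := (convex_Icc a b).norm_image_sub_le_of_norm_hasDerivWithin_le hderiv hbound ht hs
  rw [Real.norm_eq_abs, Real.norm_eq_abs] at this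
  calc _ = |√(M.f y s) - √(M.f y t)| ^ 2 := (sq_abs _).symm
    _ ≤ (√B * |s - t|) ^ 2 := by gcongr
    _ = _ := by rw [mul_pow, Real.sq_sqrt hB0, sq_abs, mul_comm]

/-- The model is Lipschitz in Hellinger distance over a window of parameters. -/
lemma exists_hellinger_le (M : BenchmarkModel) {a b : ℝ} (hab : Set.Icc a b ⊆ M.N)
    (hg : MonotoneOn M.g (Set.Icc a b)) :
    ∃ K : ℝ, 0 ≤ K ∧ ∀ s ∈ Set.Icc a b, ∀ t ∈ Set.Icc a b,
      ∫ y in Set.Ici (M.g a), (√(M.f y s) - √(M.f y t)) ^ 2 ≤ K * (s - t) ^ 2 := by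
  obtain ⟨K, hK, hfisher⟩ := M.exists_ofReal_fisher_le hab
  refine ⟨K * (∫⁻ y, M.scoreEnvelope y).toReal, by positivity, fun s hs t ht => ?_⟩
  have hpt : ∀ y ∈ Set.Ici (M.g a), ENNReal.ofReal ((√(M.f y s) - √(M.f y t)) ^ 2) ≤
      ENNReal.ofReal (K * (s - t) ^ 2) * M.scoreEnvelope y := by
    intro y hy
    rcases eq_or_ne s t with rfl | hst
    · simp
    have hcoef : 0 < K * (s - t) ^ 2 := by
      have := sub_ne_zero.2 hst
      positivity
    rcases eq_or_ne (M.scoreEnvelope y) ⊤ with htop | htop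
    · rw [htop, ENNReal.mul_top (by simpa using hcoef)]
      exact le_top
    · have hB : ∀ x ∈ Set.Icc a b, (deriv (fun t => M.f y t) x) ^ 2 / M.f y x
          ≤ K * (M.scoreEnvelope y).toReal := by
        intro x hx
        have h1 := hfisher x hx y hy (hg hx ⟨hx.1.trans hx.2, le_rfl⟩ hx.2)
        rw [← ENNReal.ofReal_toReal htop, ← ENNReal.ofReal_mul hK.le] at h1
        exact (ENNReal.ofReal_le_ofReal_iff (by positivity)).1 h1
      rw [← ENNReal.ofReal_toReal htop, ← ENNReal.ofReal_mul hcoef.le]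
      apply ENNReal.ofReal_le_ofReal
      have := M.sq_sqrt_sub_sqrt_le hab hB hs ht
      linarith
  have hle : ∫⁻ y in Set.Ici (M.g a), ENNReal.ofReal ((√(M.f y s) - √(M.f y t)) ^ 2) ≤
      ENNReal.ofReal (K * (s - t) ^ 2) * ∫⁻ y, M.scoreEnvelope y :=
    calc _ ≤ ∫⁻ y in Set.Ici (M.g a), ENNReal.ofReal (K * (s - t) ^ 2) * M.scoreEnvelope y :=
          setLIntegral_mono' measurableSet_Ici hpt
      _ ≤ ∫⁻ y, ENNReal.ofReal (K * (s - t) ^ 2) * M.scoreEnvelope y :=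
          setLIntegral_le_lintegral _ _
      _ = _ := lintegral_const_mul' _ _ ENNReal.ofReal_ne_top
  have hfin : ∫⁻ y, M.scoreEnvelope y ≠ ⊤ := M.int2.ne
  have hcont : Continuous fun y => (√(M.f y s) - √(M.f y t)) ^ 2 :=
    ((M.f_cont s (hab hs)).sqrt.sub (M.f_cont t (hab ht)).sqrt).pow 2
  rw [integral_eq_lintegral_of_nonneg_ae (Eventually.of_forall fun y => sq_nonneg _)
    hcont.aestronglyMeasurable]
  calc _ ≤ (ENNReal.ofReal (K * (s - t) ^ 2) * ∫⁻ y, M.scoreEnvelope y).toReal :=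
        ENNReal.toReal_mono (ENNReal.mul_ne_top ENNReal.ofReal_ne_top hfin) hle
    _ = _ := by
      rw [ENNReal.toReal_mul, ENNReal.toReal_ofReal (by positivity)]
      ring

lemma integrableOn_Ici (M : BenchmarkModel) {θ : ℝ} (hθ : θ ∈ M.N) (c : ℝ) :
    IntegrableOn (fun y => M.f y θ) (Set.Ici c) := by
  have h1 : IntegrableOn (fun y => M.f y θ) (Set.Icc c (M.g θ)) :=
    (M.f_cont θ hθ).continuousOn.integrableOn_compact isCompact_Icc
  refine (h1.union (M.f_integrable θ)).mono_set fun y hy => ?_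
  rcases le_total y (M.g θ) with h | h
  · exact Or.inl ⟨hy, h⟩
  · exact Or.inr h

lemma setIntegral_Ici_eq (M : BenchmarkModel) {θ : ℝ} (hθ : θ ∈ M.N) (c : ℝ) :
    ∫ y in Set.Ici c, M.f y θ = 1 + ∫ y in c..M.g θ, M.f y θ := by
  have h := intervalIntegral.integral_interval_add_Ioi
    ((M.integrableOn_Ici hθ c).mono_set Set.Ioi_subset_Ici_self)
    ((M.integrableOn_Ici hθ (M.g θ)).mono_set Set.Ioi_subset_Ici_self)
  rw [integral_Ici_eq_integral_Ioi, ← h, ← integral_Ici_eq_integral_Ioi, M.f_density, add_comm]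

lemma integrableOn_sq_sqrt_sub (M : BenchmarkModel) {s t : ℝ} (hs : s ∈ M.N) (ht : t ∈ M.N)
    (c : ℝ) : IntegrableOn (fun y => (√(M.f y s) - √(M.f y t)) ^ 2) (Set.Ici c) := by
  have hcont : Continuous fun y => (√(M.f y s) - √(M.f y t)) ^ 2 :=
    ((M.f_cont s hs).sqrt.sub (M.f_cont t ht).sqrt).pow 2
  refine ((M.integrableOn_Ici hs c).add (M.integrableOn_Ici ht c)).mono'
    hcont.aestronglyMeasurable (Eventually.of_forall fun y => ?_)
  have h1 := M.f_pos s hs y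
  have h2 := M.f_pos t ht y
  rw [Real.norm_of_nonneg (sq_nonneg _)]
  simp only [Pi.add_apply]
  nlinarith [Real.sq_sqrt h1.le, Real.sq_sqrt h2.le, Real.sqrt_nonneg (M.f y s),
    Real.sqrt_nonneg (M.f y t), mul_nonneg (Real.sqrt_nonneg (M.f y s))
    (Real.sqrt_nonneg (M.f y t))]

lemma abs_sub_le_hellinger (M : BenchmarkModel) {s t : ℝ} (hs : s ∈ M.N) (ht : t ∈ M.N)
    {τ : ℝ} (hτ : 0 < τ) (y : ℝ) :
    |M.f y s - M.f y t| ≤ 2 * √M.C * (τ + (√(M.f y s) - √(M.f y t)) ^ 2 / τ) := by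
  have h1 := M.f_pos s hs y
  have h2 := M.f_pos t ht y
  have e : M.f y s - M.f y t = (√(M.f y s) - √(M.f y t)) * (√(M.f y s) + √(M.f y t)) := by
    have := Real.sq_sqrt h1.le
    have := Real.sq_sqrt h2.le
    nlinarith
  have h3 : √(M.f y s) ≤ √M.C := Real.sqrt_le_sqrt (M.f_lt s hs y).le
  have h4 : √(M.f y t) ≤ √M.C := Real.sqrt_le_sqrt (M.f_lt t ht y).le
  have h5 : |√(M.f y s) - √(M.f y t)| ≤ τ + (√(M.f y s) - √(M.f y t)) ^ 2 / τ := by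
    set d := √(M.f y s) - √(M.f y t)
    rw [← sub_le_iff_le_add', le_div_iff₀ hτ, ← sq_abs]
    nlinarith [sq_nonneg (|d| - τ), abs_nonneg d]
  rw [e, abs_mul, abs_of_nonneg (by positivity : 0 ≤ √(M.f y s) + √(M.f y t))]
  calc |√(M.f y s) - √(M.f y t)| * (√(M.f y s) + √(M.f y t))
      ≤ (τ + (√(M.f y s) - √(M.f y t)) ^ 2 / τ) * (√M.C + √M.C) := by gcongr
    _ = _ := by ring

lemma abs_intervalIntegral_sub_le (M : BenchmarkModel) {s t : ℝ} (hs : s ∈ M.N) (ht : t ∈ M.N)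
    {τ : ℝ} (hτ : 0 < τ) {c x x' : ℝ} (hx : c ≤ x) (hx' : c ≤ x') :
    |∫ y in x..x', (M.f y s - M.f y t)| ≤
      2 * √M.C * (τ * |x' - x| + (∫ y in Set.Ici c, (√(M.f y s) - √(M.f y t)) ^ 2) / τ) := by
  have hH := M.integrableOn_sq_sqrt_sub hs ht c
  have hsub : Set.uIoc x x' ⊆ Set.Ici c := fun y hy => (le_min hx hx').trans hy.1.le
  have hHs := hH.mono_set hsub
  have hc : IntegrableOn (fun _ : ℝ => τ) (Set.uIoc x x') :=
    integrableOn_const (by simp [Set.uIoc, Real.volume_Ioc])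
  calc |∫ y in x..x', (M.f y s - M.f y t)|
      ≤ ∫ y in Set.uIoc x x', |M.f y s - M.f y t| := by
        simpa using intervalIntegral.norm_integral_le_integral_norm_uIoc
          (f := fun y => M.f y s - M.f y t) (a := x) (b := x') (μ := volume)
    _ ≤ ∫ y in Set.uIoc x x', 2 * √M.C * (τ + (√(M.f y s) - √(M.f y t)) ^ 2 / τ) := by
        refine integral_mono_of_nonneg (Eventually.of_forall fun y => abs_nonneg _)
          ((hc.add (hHs.div_const τ)).const_mul _)
          (Eventually.of_forall fun y => M.abs_sub_le_hellinger hs ht hτ y)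
    _ = 2 * √M.C * (τ * |x' - x| +
          (∫ y in Set.uIoc x x', (√(M.f y s) - √(M.f y t)) ^ 2) / τ) := by
        rw [integral_const_mul, integral_add hc (hHs.div_const τ), integral_div]
        simp [Set.uIoc, Measure.real, max_sub_min_eq_abs, mul_comm]
    _ ≤ _ := by
        have := setIntegral_mono_set hH (Eventually.of_forall fun y => sq_nonneg _)
          hsub.eventuallyLE
        gcongr

lemma tendsto_mul_comp_add_div {G : ℝ → ℝ} {x G' : ℝ} (hG : HasDerivAt G G' x) (h : ℝ) :
    Tendsto (fun n : ℕ => (n : ℝ) * (G (x + h / n) - G x)) atTop (𝓝 (h * G')) := by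
  have h1 : HasDerivAt (fun t => G (x + h * t)) (h * G') 0 := by
    have h2 : HasDerivAt (fun t : ℝ => x + h * t) h 0 := by
      simpa using ((hasDerivAt_id (0 : ℝ)).const_mul h).const_add x
    have h3 : HasDerivAt G G' (x + h * 0) := by simpa using hG
    rw [mul_comm]
    exact h3.comp (0 : ℝ) h2
  have h4 : Tendsto (fun n : ℕ => ((n : ℝ))⁻¹) atTop (𝓝[≠] 0) := by
    refine tendsto_nhdsWithin_iff.2 ⟨tendsto_inv_atTop_nhds_zero_nat, ?_⟩
    filter_upwards [eventually_ne_atTop 0] with n hn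
    simpa using hn
  have h5 := (hasDerivAt_iff_tendsto_slope.1 h1).comp h4
  refine h5.congr fun n => ?_
  simp [slope, div_eq_mul_inv]

/-- A parameter window around `θ0` inside `N` on which `g` is increasing. -/
lemma exists_window (M : BenchmarkModel) :
    ∃ a b : ℝ, a < M.θ0 ∧ M.θ0 < b ∧ Set.Icc a b ⊆ M.N ∧ StrictMonoOn M.g (Set.Icc a b) := by
  have hcont : Continuous (deriv M.g) := M.g_smooth.continuous_deriv le_rfl
  have h1 : ∀ᶠ θ in 𝓝 M.θ0, θ ∈ M.N ∧ 0 < deriv M.g θ :=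
    Filter.Eventually.and (M.N_open.mem_nhds M.θ0_mem)
      (hcont.continuousAt.eventually (lt_mem_nhds M.g_deriv_pos))
  obtain ⟨ε, hε, hball⟩ := Metric.nhds_basis_closedBall.eventually_iff.1 h1
  rw [Real.closedBall_eq_Icc] at hball
  refine ⟨M.θ0 - ε, M.θ0 + ε, by linarith, by linarith, fun θ hθ => (hball hθ).1, ?_⟩
  refine strictMonoOn_of_deriv_pos (convex_Icc _ _) M.g_smooth.continuous.continuousOn
    fun x hx => (hball (interior_subset hx)).2

lemma tendsto_add_div_nat (x h : ℝ) : Tendsto (fun n : ℕ => x + h / n) atTop (𝓝 x) := by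
  simpa using (tendsto_const_div_atTop_nhds_zero_nat h).const_add x

lemma lam_inv (M : BenchmarkModel) : M.lam⁻¹ = M.f (M.g M.θ0) M.θ0 * deriv M.g M.θ0 := by
  simp [lam]

lemma lam_pos (M : BenchmarkModel) : 0 < M.lam :=
  inv_pos.2 (mul_pos (M.f_pos _ M.θ0_mem _) M.g_deriv_pos)

/-- Probability of observing a value between two boundary points at distance `O(1/n)`. -/
lemma tendsto_mul_intervalIntegral (M : BenchmarkModel) (h h' u : ℝ) :
    Tendsto (fun n : ℕ => (n : ℝ) *
      ∫ y in M.g (M.θ0 + h / n)..M.g (M.θ0 + h' / n), M.f y (M.θ0 + u / n))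
      atTop (𝓝 ((h' - h) / M.lam)) := by
  obtain ⟨a, b, ha, hb, hab, hg⟩ := M.exists_window
  obtain ⟨K, hK, hHell⟩ := M.exists_hellinger_le hab hg.monotoneOn
  have hθ0 : M.θ0 ∈ Set.Icc a b := ⟨ha.le, hb.le⟩
  have hmem : ∀ v : ℝ, ∀ᶠ n : ℕ in atTop, M.θ0 + v / n ∈ Set.Icc a b := fun v =>
    (tendsto_add_div_nat M.θ0 v).eventually (Icc_mem_nhds ha hb)
  have hint : ∀ θ ∈ Set.Icc a b, ∀ x x' : ℝ,
      IntervalIntegrable (fun y => M.f y θ) volume x x' := fun θ hθ x x' =>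
    (M.f_cont θ (hab hθ)).intervalIntegrable x x'
  have hgd : HasDerivAt M.g (deriv M.g M.θ0) M.θ0 :=
    (M.g_smooth.differentiable (by norm_num) _).hasDerivAt
  have hΦ : HasDerivAt (fun θ => ∫ y in M.g M.θ0..M.g θ, M.f y M.θ0) M.lam⁻¹ M.θ0 := by
    rw [lam_inv]
    exact (intervalIntegral.integral_hasDerivAt_right (hint _ hθ0 _ _)
      ((M.f_cont _ M.θ0_mem).stronglyMeasurableAtFilter _ _)
      (M.f_cont _ M.θ0_mem).continuousAt).comp (𝕜 := ℝ) M.θ0 hgd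
  have hmain : Tendsto (fun n : ℕ => (n : ℝ) *
      ∫ y in M.g (M.θ0 + h / n)..M.g (M.θ0 + h' / n), M.f y M.θ0)
      atTop (𝓝 ((h' - h) / M.lam)) := by
    have := (tendsto_mul_comp_add_div hΦ h').sub (tendsto_mul_comp_add_div hΦ h)
    rw [← sub_mul, ← div_eq_mul_inv] at this
    refine this.congr fun n => ?_
    rw [intervalIntegral.integral_same, sub_zero, sub_zero, ← mul_sub,
      intervalIntegral.integral_interval_sub_left (hint _ hθ0 _ _) (hint _ hθ0 _ _)]
  have hgap : Tendsto (fun n : ℕ => |(n : ℝ) * (M.g (M.θ0 + h' / n) - M.g (M.θ0 + h / n))|)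
      atTop (𝓝 |(h' - h) * deriv M.g M.θ0|) := by
    have := ((tendsto_mul_comp_add_div hgd h').sub (tendsto_mul_comp_add_div hgd h)).abs
    rw [← sub_mul] at this
    exact this.congr fun n => by congr 1; ring
  have hτ0 : Tendsto (fun n : ℕ => 1 / √(n : ℝ)) atTop (𝓝 0) := by
    have := (tendsto_sqrt_atTop.comp tendsto_natCast_atTop_atTop).inv_tendsto_atTop (𝕜 := ℝ)
    exact this.congr fun n => by simp
  have hbound : Tendsto (fun n : ℕ => 2 * √M.C * (1 / √(n : ℝ) *
      |(n : ℝ) * (M.g (M.θ0 + h' / n) - M.g (M.θ0 + h / n))| + K * u ^ 2 * (1 / √(n : ℝ))))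
      atTop (𝓝 0) := by
    simpa using ((hτ0.mul hgap).add (hτ0.const_mul (K * u ^ 2))).const_mul (2 * √M.C)
  have hrem : Tendsto (fun n : ℕ => (n : ℝ) *
      ∫ y in M.g (M.θ0 + h / n)..M.g (M.θ0 + h' / n),
        (M.f y (M.θ0 + u / n) - M.f y M.θ0)) atTop (𝓝 0) := by
    refine squeeze_zero_norm' ?_ hbound
    filter_upwards [hmem h, hmem h', hmem u, eventually_gt_atTop 0] with n hh hh' hu hn
    have hn' : (0 : ℝ) < n := by exact_mod_cast hn
    have hab' : a ≤ b := (ha.trans hb).le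
    have key := M.abs_intervalIntegral_sub_le (hab hu) M.θ0_mem
      (τ := 1 / √(n : ℝ)) (by positivity)
      (hg.monotoneOn ⟨le_rfl, hab'⟩ hh hh.1) (hg.monotoneOn ⟨le_rfl, hab'⟩ hh' hh'.1)
    have hH := hHell _ hu _ hθ0
    rw [norm_mul, Real.norm_eq_abs, Real.norm_eq_abs, abs_of_pos hn', abs_mul, abs_of_pos hn']
    have hs : √(n : ℝ) ^ 2 = n := Real.sq_sqrt hn'.le
    have hs0 : 0 < √(n : ℝ) := Real.sqrt_pos.2 hn'
    calc _ ≤ (n : ℝ) * (2 * √M.C * (1 / √(n : ℝ) *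
            |M.g (M.θ0 + h' / n) - M.g (M.θ0 + h / n)| +
            K * (M.θ0 + u / n - M.θ0) ^ 2 / (1 / √(n : ℝ)))) := by
          refine mul_le_mul_of_nonneg_left (key.trans ?_) hn'.le
          gcongr
      _ = _ := by
          have e : (n : ℝ) * (K * (M.θ0 + u / n - M.θ0) ^ 2 / (1 / √(n : ℝ))) =
              K * u ^ 2 * (1 / √(n : ℝ)) := by
            rw [add_sub_cancel_left]
            field_simp
            rw [hs]
            ring
          rw [← e]
          ring
  have := hmain.add hrem
  rw [add_zero] at this
  refine this.congr' ?_
  filter_upwards [hmem u] with n hu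
  rw [← mul_add, intervalIntegral.integral_sub (hint _ hu _ _) (hint _ hθ0 _ _)]
  ring

/-- Tail probabilities of a single observation, localized at the boundary. -/
lemma tendsto_mul_setIntegral_Ici_sub_one (M : BenchmarkModel) (h u : ℝ) :
    Tendsto (fun n : ℕ => (n : ℝ) *
      ((∫ y in Set.Ici (M.g (M.θ0 + h / n)), M.f y (M.θ0 + u / n)) - 1))
      atTop (𝓝 ((u - h) / M.lam)) := by
  refine (M.tendsto_mul_intervalIntegral h u u).congr' ?_
  filter_upwards [(tendsto_add_div_nat M.θ0 u).eventually (M.N_open.mem_nhds M.θ0_mem)] with n hn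
  rw [M.setIntegral_Ici_eq hn]
  ring

/-- The law of a single observation. -/
def obs (M : BenchmarkModel) (θ : ℝ) : Measure ℝ :=
  (volume.restrict (Set.Ici (M.g θ))).withDensity fun y => ENNReal.ofReal (M.f y θ)

lemma obs_eq (M : BenchmarkModel) (θ : ℝ) :
    M.obs θ = volume.withDensity
      fun y => ENNReal.ofReal (M.f y θ * if M.g θ ≤ y then 1 else 0) := by
  rw [obs, ← withDensity_indicator measurableSet_Ici]
  congr 1
  ext y
  by_cases h : M.g θ ≤ y <;> simp [Set.indicator, h]

lemma integral_obs (M : BenchmarkModel) {θ : ℝ} (hθ : θ ∈ M.N) (φ : ℝ → ℝ) :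
    ∫ y, φ y ∂M.obs θ = ∫ y in Set.Ici (M.g θ), M.f y θ * φ y := by
  rw [obs, integral_withDensity_eq_integral_toReal_smul
    (M.f_cont θ hθ).measurable.ennreal_ofReal (by simp)]
  simp [ENNReal.toReal_ofReal (M.f_pos θ hθ _).le]

lemma integrable_obs_iff (M : BenchmarkModel) {θ : ℝ} (hθ : θ ∈ M.N) (φ : ℝ → ℝ) :
    Integrable φ (M.obs θ) ↔ IntegrableOn (fun y => M.f y θ * φ y) (Set.Ici (M.g θ)) := by
  rw [obs, integrable_withDensity_iff_integrable_smul'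
    (M.f_cont θ hθ).measurable.ennreal_ofReal (by simp)]
  simp [ENNReal.toReal_ofReal (M.f_pos θ hθ _).le, IntegrableOn]

lemma isProbabilityMeasure_obs (M : BenchmarkModel) {θ : ℝ} (hθ : θ ∈ M.N) :
    IsProbabilityMeasure (M.obs θ) := by
  refine ⟨?_⟩
  rw [obs, withDensity_apply _ MeasurableSet.univ, Measure.restrict_univ,
    ← ofReal_integral_eq_lintegral_ofReal (M.f_integrable θ)
      (Eventually.of_forall fun y => (M.f_pos θ hθ y).le), M.f_density, ENNReal.ofReal_one]

lemma ae_obs (M : BenchmarkModel) (θ : ℝ) : ∀ᵐ y ∂M.obs θ, M.g θ ≤ y :=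
  (withDensity_absolutelyContinuous _ _).ae_le (ae_restrict_mem measurableSet_Ici)

lemma P_eq_pi (M : BenchmarkModel) (n : ℕ) {θ : ℝ} (hθ : θ ∈ M.N) :
    M.P n θ = Measure.pi fun _ => M.obs θ := by
  have := M.isProbabilityMeasure_obs hθ
  set d : ℝ → ℝ := fun y => M.f y θ * if M.g θ ≤ y then 1 else 0 with hd
  have hd0 : ∀ y, 0 ≤ d y := fun y => by
    have := M.f_pos θ hθ y
    simp only [hd]
    split_ifs <;> simp [this.le]
  have hdi : Integrable d := by
    refine (integrable_indicator_iff measurableSet_Ici).2 (M.f_integrable θ) |>.congr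
      (Eventually.of_forall fun y => ?_)
    by_cases h : M.g θ ≤ y <;> simp [Set.indicator, h, hd]
  refine (Measure.pi_eq fun s hs => ?_).symm
  have hrect : ∀ i, M.obs θ (s i) = ENNReal.ofReal (∫ y, (s i).indicator d y) := fun i => by
    rw [integral_indicator (hs i), ofReal_integral_eq_lintegral_ofReal hdi.integrableOn
      (Eventually.of_forall hd0), obs_eq, withDensity_apply _ (hs i)]
  have hprod : (fun y : Fin n → ℝ => (Set.univ.pi s).indicator (fun y => ∏ i, d (y i)) y) =
      fun y => ∏ i, (s i).indicator d (y i) := by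
    ext y
    by_cases h : y ∈ Set.univ.pi s
    · rw [Set.indicator_of_mem h]
      exact Finset.prod_congr rfl fun i _ => (Set.indicator_of_mem (h i trivial) _).symm
    · rw [Set.indicator_of_notMem h]
      simp only [Set.mem_pi, Set.mem_univ, true_imp_iff, not_forall] at h
      obtain ⟨i, hi⟩ := h
      exact (Finset.prod_eq_zero (Finset.mem_univ i) (Set.indicator_of_notMem hi _)).symm
  have hpi : MeasurableSet (Set.univ.pi s) := MeasurableSet.univ_pi hs
  have hint : Integrable fun y : Fin n → ℝ => ∏ i, d (y i) :=
    Integrable.fintype_prod fun _ => hdi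
  calc M.P n θ (Set.univ.pi s)
      = ∫⁻ y in Set.univ.pi s, ENNReal.ofReal (∏ i, d (y i)) := withDensity_apply _ hpi
    _ = ENNReal.ofReal (∫ y in Set.univ.pi s, ∏ i, d (y i)) :=
        (ofReal_integral_eq_lintegral_ofReal hint.integrableOn
          (Eventually.of_forall fun y => Finset.prod_nonneg fun i _ => hd0 _)).symm
    _ = ENNReal.ofReal (∏ i, ∫ y, (s i).indicator d y) := by
        rw [← integral_indicator hpi, hprod,
          integral_fintype_prod_volume_eq_prod (fun i => (s i).indicator d)]
    _ = _ := by
        rw [ENNReal.ofReal_prod_of_nonneg fun i _ => integral_nonneg fun y =>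
          Set.indicator_nonneg (fun y _ => hd0 y) y]
        exact Finset.prod_congr rfl fun i _ => (hrect i).symm

lemma isProbabilityMeasure_P (M : BenchmarkModel) (n : ℕ) {θ : ℝ} (hθ : θ ∈ M.N) :
    IsProbabilityMeasure (M.P n θ) := by
  have := M.isProbabilityMeasure_obs hθ
  rw [M.P_eq_pi n hθ]
  infer_instance

lemma ae_P (M : BenchmarkModel) (n : ℕ) {θ : ℝ} (hθ : θ ∈ M.N) :
    ∀ᵐ y ∂M.P n θ, ∀ i, M.g θ ≤ y i := by
  have := M.isProbabilityMeasure_obs hθ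
  rw [M.P_eq_pi n hθ, ae_all_iff]
  exact fun i => (Measure.quasiMeasurePreserving_eval (fun _ : Fin n => M.obs θ) i).ae (M.ae_obs θ)

lemma integral_P_prod (M : BenchmarkModel) (n : ℕ) {θ : ℝ} (hθ : θ ∈ M.N) (φ : ℝ → ℝ) :
    ∫ y, ∏ i, φ (y i) ∂M.P n θ = (∫ y in Set.Ici (M.g θ), M.f y θ * φ y) ^ n := by
  have := M.isProbabilityMeasure_obs hθ
  rw [M.P_eq_pi n hθ, integral_fintype_prod_eq_pow, M.integral_obs hθ, Fintype.card_fin]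

lemma integrable_P_prod (M : BenchmarkModel) (n : ℕ) {θ : ℝ} (hθ : θ ∈ M.N) {φ : ℝ → ℝ}
    (hφ : IntegrableOn (fun y => M.f y θ * φ y) (Set.Ici (M.g θ))) :
    Integrable (fun y => ∏ i, φ (y i)) (M.P n θ) := by
  have := M.isProbabilityMeasure_obs hθ
  rw [M.P_eq_pi n hθ]
  exact Integrable.fintype_prod fun _ => (M.integrable_obs_iff hθ φ).2 hφ

/-- Square root of the likelihood ratio of parameter `θ'` against `θ`. -/
def sqrtLR (M : BenchmarkModel) (n : ℕ) (θ θ' : ℝ) (y : Fin n → ℝ) : ℝ :=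
  ∏ i, √(M.f (y i) θ' / M.f (y i) θ)

lemma sqrtLR_sq (M : BenchmarkModel) (n : ℕ) {θ θ' : ℝ} (hθ : θ ∈ M.N) (hθ' : θ' ∈ M.N)
    (y : Fin n → ℝ) : M.sqrtLR n θ θ' y ^ 2 = ∏ i, M.f (y i) θ' / M.f (y i) θ := by
  rw [sqrtLR, ← Finset.prod_pow]
  exact Finset.prod_congr rfl fun i _ =>
    Real.sq_sqrt (div_pos (M.f_pos _ hθ' _) (M.f_pos _ hθ _)).le

lemma mul_sqrt_div (M : BenchmarkModel) {θ θ' : ℝ} (hθ : θ ∈ M.N) (hθ' : θ' ∈ M.N) (y : ℝ) :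
    M.f y θ * √(M.f y θ' / M.f y θ) =
      (1 / 2) * ((M.f y θ' + M.f y θ) - (√(M.f y θ') - √(M.f y θ)) ^ 2) := by
  have h1 := M.f_pos θ hθ y
  have h2 := M.f_pos θ' hθ' y
  have e1 := Real.sq_sqrt h1.le
  have e2 := Real.sq_sqrt h2.le
  have h3 := Real.sqrt_pos.2 h1
  rw [Real.sqrt_div h2.le]
  have : M.f y θ * (√(M.f y θ') / √(M.f y θ)) = √(M.f y θ') * √(M.f y θ) := by
    nth_rewrite 1 [← e1]
    field_simp
  rw [this]
  nlinarith

lemma integrable_sqrtLR (M : BenchmarkModel) (n : ℕ) {θ θ' : ℝ} (hθ : θ ∈ M.N)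
    (hθ' : θ' ∈ M.N) : Integrable (M.sqrtLR n θ θ') (M.P n θ) := by
  refine M.integrable_P_prod n hθ (φ := fun y => √(M.f y θ' / M.f y θ)) ?_
  simp_rw [M.mul_sqrt_div hθ hθ']
  exact (((M.integrableOn_Ici hθ' _).add (M.integrableOn_Ici hθ _)).sub
    (M.integrableOn_sq_sqrt_sub hθ' hθ _)).const_mul _

lemma mul_div_f (M : BenchmarkModel) {θ : ℝ} (hθ : θ ∈ M.N) (θ' y : ℝ) :
    M.f y θ * (M.f y θ' / M.f y θ) = M.f y θ' :=
  mul_div_cancel₀ _ (M.f_pos θ hθ y).ne'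

lemma integrable_sqrtLR_sq (M : BenchmarkModel) (n : ℕ) {θ θ' : ℝ} (hθ : θ ∈ M.N)
    (hθ' : θ' ∈ M.N) : Integrable (fun y => M.sqrtLR n θ θ' y ^ 2) (M.P n θ) := by
  simp_rw [M.sqrtLR_sq n hθ hθ']
  refine M.integrable_P_prod n hθ (φ := fun y => M.f y θ' / M.f y θ) ?_
  simp_rw [M.mul_div_f hθ]
  exact M.integrableOn_Ici hθ' _

lemma integral_sqrtLR_sq (M : BenchmarkModel) (n : ℕ) {θ θ' : ℝ} (hθ : θ ∈ M.N)
    (hθ' : θ' ∈ M.N) :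
    ∫ y, M.sqrtLR n θ θ' y ^ 2 ∂M.P n θ = (∫ y in Set.Ici (M.g θ), M.f y θ') ^ n := by
  simp_rw [M.sqrtLR_sq n hθ hθ']
  rw [M.integral_P_prod n hθ (fun y => M.f y θ' / M.f y θ)]
  simp_rw [M.mul_div_f hθ]

lemma integral_sqrtLR (M : BenchmarkModel) (n : ℕ) {θ θ' : ℝ} (hθ : θ ∈ M.N)
    (hθ' : θ' ∈ M.N) :
    ∫ y, M.sqrtLR n θ θ' y ∂M.P n θ =
      ((1 / 2) * (((∫ y in Set.Ici (M.g θ), M.f y θ') + 1) -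
        ∫ y in Set.Ici (M.g θ), (√(M.f y θ') - √(M.f y θ)) ^ 2)) ^ n := by
  simp only [sqrtLR]
  rw [M.integral_P_prod n hθ (fun y => √(M.f y θ' / M.f y θ))]
  simp_rw [M.mul_sqrt_div hθ hθ']
  have hadd : IntegrableOn (fun y => M.f y θ' + M.f y θ) (Set.Ici (M.g θ)) :=
    (M.integrableOn_Ici hθ' _).add (M.integrableOn_Ici hθ _)
  rw [integral_const_mul, integral_sub hadd (M.integrableOn_sq_sqrt_sub hθ' hθ _),
    integral_add (M.integrableOn_Ici hθ' _) (M.integrableOn_Ici hθ _), M.f_density]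

lemma eventually_mem_N (M : BenchmarkModel) (h : ℝ) :
    ∀ᶠ n : ℕ in atTop, M.θ0 + h / n ∈ M.N :=
  (tendsto_add_div_nat M.θ0 h).eventually (M.N_open.mem_nhds M.θ0_mem)

lemma tendsto_mul_hellinger (M : BenchmarkModel) (h h' : ℝ) :
    Tendsto (fun n : ℕ => (n : ℝ) * ∫ y in Set.Ici (M.g (M.θ0 + h / n)),
      (√(M.f y (M.θ0 + h' / n)) - √(M.f y (M.θ0 + h / n))) ^ 2) atTop (𝓝 0) := by
  obtain ⟨a, b, ha, hb, hab, hg⟩ := M.exists_window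
  obtain ⟨K, hK, hHell⟩ := M.exists_hellinger_le hab hg.monotoneOn
  have hmem : ∀ v : ℝ, ∀ᶠ n : ℕ in atTop, M.θ0 + v / n ∈ Set.Icc a b := fun v =>
    (tendsto_add_div_nat M.θ0 v).eventually (Icc_mem_nhds ha hb)
  refine squeeze_zero' (Eventually.of_forall fun n => mul_nonneg n.cast_nonneg
    (integral_nonneg fun y => sq_nonneg _)) ?_
    (tendsto_const_div_atTop_nhds_zero_nat (K * (h' - h) ^ 2))
  filter_upwards [hmem h, hmem h', eventually_gt_atTop 0] with n hn hn' hpos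
  have hpos' : (0 : ℝ) < n := by exact_mod_cast hpos
  have h1 := setIntegral_mono_set (M.integrableOn_sq_sqrt_sub (hab hn') (hab hn) (M.g a))
    (Eventually.of_forall fun y => sq_nonneg _)
    (Set.Ici_subset_Ici.2 (hg.monotoneOn ⟨le_rfl, (ha.trans hb).le⟩ hn hn.1)).eventuallyLE
  calc _ ≤ (n : ℝ) * (K * (M.θ0 + h' / n - (M.θ0 + h / n)) ^ 2) :=
        mul_le_mul_of_nonneg_left (h1.trans (hHell _ hn' _ hn)) hpos'.le
    _ = _ := by
        field_simp
        ring

/-- `L²` convergence of the square root of the likelihood ratio to a constant. -/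
lemma tendsto_integral_sqrtLR_sub_sq (M : BenchmarkModel) (h h' : ℝ) :
    Tendsto (fun n : ℕ => ∫ y, (M.sqrtLR n (M.θ0 + h / n) (M.θ0 + h' / n) y -
      exp ((h' - h) / M.lam / 2)) ^ 2 ∂M.P n (M.θ0 + h / n)) atTop (𝓝 0) := by
  set c := exp ((h' - h) / M.lam / 2) with hc
  have hc2 : exp ((h' - h) / M.lam) = c ^ 2 := by
    rw [hc, ← Real.exp_nat_mul]
    congr 1
    push_cast
    ring
  set q : ℕ → ℝ := fun n => ∫ y in Set.Ici (M.g (M.θ0 + h / n)), M.f y (M.θ0 + h' / n) with hq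
  set H : ℕ → ℝ := fun n => ∫ y in Set.Ici (M.g (M.θ0 + h / n)),
      (√(M.f y (M.θ0 + h' / n)) - √(M.f y (M.θ0 + h / n))) ^ 2 with hH
  have h1 : Tendsto (fun n : ℕ => (1 + (q n - 1)) ^ n) atTop (𝓝 (c ^ 2)) := by
    rw [← hc2]
    exact Real.tendsto_one_add_pow_exp_of_tendsto (M.tendsto_mul_setIntegral_Ici_sub_one h h')
  have h2 : Tendsto (fun n : ℕ => (1 + (1 / 2) * ((q n - 1) - H n)) ^ n) atTop (𝓝 c) := by
    refine Real.tendsto_one_add_pow_exp_of_tendsto ?_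
    have := ((M.tendsto_mul_setIntegral_Ici_sub_one h h').sub
      (M.tendsto_mul_hellinger h h')).const_mul (1 / 2)
    rw [sub_zero, one_div_mul_eq_div] at this
    exact this.congr fun n => by ring
  have h3 : Tendsto (fun n : ℕ => (1 + (q n - 1)) ^ n -
      2 * c * (1 + (1 / 2) * ((q n - 1) - H n)) ^ n + c ^ 2) atTop (𝓝 0) := by
    have := (h1.sub (h2.const_mul (2 * c))).add_const (c ^ 2)
    convert this using 2
    ring
  refine h3.congr' ?_
  filter_upwards [M.eventually_mem_N h, M.eventually_mem_N h'] with n hn hn'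
  have := M.isProbabilityMeasure_P n hn
  have e1 := M.integral_sqrtLR_sq n hn hn'
  have e2 := M.integral_sqrtLR n hn hn'
  have i1 := M.integrable_sqrtLR_sq n hn hn'
  have i2 := M.integrable_sqrtLR n hn hn'
  simp_rw [sub_sq, mul_right_comm (2 : ℝ) _ c]
  have i3 := i2.const_mul (2 * c)
  have i4 : Integrable (fun y => M.sqrtLR n (M.θ0 + h / n) (M.θ0 + h' / n) y ^ 2 -
      2 * c * M.sqrtLR n (M.θ0 + h / n) (M.θ0 + h' / n) y) (M.P n (M.θ0 + h / n)) := i1.sub i3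
  rw [integral_add i4 (integrable_const _), integral_sub i1 i3, integral_const_mul, e1, e2]
  simp only [integral_const, probReal_univ, one_smul]
  congr 4
  · ring
  · ring

/-- Möbius expansion of a function of finitely many events. -/
lemma exists_sum_ite_eq {ι : Type*} [Fintype ι] (φ : Set ι → ℝ) :
    ∃ ψ : Finset ι → ℝ, ∀ p : ι → Prop,
      φ {j | p j} = ∑ S : Finset ι, ψ S * if ∀ j ∈ S, p j then 1 else 0 := by
  let ψ : Finset ι → ℝ := Finset.strongInduction fun T ih =>
    φ T - ∑ S ∈ T.ssubsets.attach, ih S.1 (Finset.mem_ssubsets.1 S.2)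
  have hψ : ∀ T : Finset ι, φ T = ∑ S ∈ T.powerset, ψ S := fun T => by
    have h1 : ψ T = φ T - ∑ S ∈ T.ssubsets, ψ S := by
      rw [← Finset.sum_attach]
      exact Finset.strongInduction_eq _ T
    rw [← Finset.insert_erase (Finset.mem_powerset_self T), Finset.sum_insert (by simp)]
    change _ = _ + ∑ S ∈ T.ssubsets, ψ S
    rw [h1]
    ring
  refine ⟨ψ, fun p => ?_⟩
  have h1 := hψ (Finset.univ.filter p)
  rw [Finset.coe_filter_univ] at h1
  rw [h1]
  simp only [mul_ite, mul_one, mul_zero]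
  rw [← Finset.sum_filter]
  refine Finset.sum_congr ?_ fun _ _ => rfl
  ext S
  simp [Finset.subset_iff]

lemma exists_abs_sub_le {k : ℕ} (F : BoundedContinuousFunction (Fin k → ℝ) ℝ)
    {K : Set (Fin k → ℝ)} (hK : IsCompact K) (c : Fin k → ℝ) {ε : ℝ} (hε : 0 < ε) :
    ∃ R : ℝ, 0 ≤ R ∧ ∀ v ∈ K, ∀ z x : Fin k → ℝ, (∀ j, |z j - v j| ≤ |x j ^ 2 - c j ^ 2|) →
      |F z - F v| ≤ ε + R * ∑ j, (x j - c j) ^ 2 := by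
  obtain ⟨δ, hδ, hδF⟩ := Metric.mem_uniformity_dist.1
    (hK.uniformContinuousAt_of_continuousAt F (fun v _ => F.continuous.continuousAt)
      (Metric.dist_mem_uniformity hε))
  have hcont : Continuous fun x : Fin k → ℝ => fun j => x j ^ 2 := by fun_prop
  obtain ⟨η, hη, hηx⟩ := Metric.continuous_iff.1 hcont c δ hδ
  refine ⟨2 * ‖F‖ / η ^ 2, by positivity, fun v hv z x hzx => ?_⟩
  have hsum : 0 ≤ ∑ j, (x j - c j) ^ 2 := Finset.sum_nonneg fun j _ => sq_nonneg _
  rcases lt_or_ge (dist x c) η with hlt | hge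
  · have h1 := hηx x hlt
    have h2 : dist v z < δ := by
      rw [dist_comm, dist_pi_lt_iff hδ]
      intro j
      rw [Real.dist_eq]
      exact (hzx j).trans_lt ((dist_pi_lt_iff hδ).1 h1 j)
    have h3 : dist (F v) (F z) < ε := hδF h2 hv
    rw [dist_comm, Real.dist_eq] at h3
    have : 0 ≤ 2 * ‖F‖ / η ^ 2 * ∑ j, (x j - c j) ^ 2 := by positivity
    linarith
  · obtain ⟨j, hj⟩ : ∃ j, η ≤ |x j - c j| := by
      by_contra! hcon
      exact absurd ((dist_pi_lt_iff hη).2 fun j => by rw [Real.dist_eq]; exact hcon j) hge.not_gt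
    have h1 : η ^ 2 ≤ ∑ j, (x j - c j) ^ 2 := by
      refine le_trans ?_ (Finset.single_le_sum (f := fun j => (x j - c j) ^ 2)
        (fun j _ => sq_nonneg _) (Finset.mem_univ j))
      rw [← sq_abs (x j - c j)]
      gcongr
    have h2 : |F z - F v| ≤ 2 * ‖F‖ := F.dist_le_two_norm z v
    have h3 : 2 * ‖F‖ ≤ 2 * ‖F‖ / η ^ 2 * ∑ j, (x j - c j) ^ 2 := by
      rw [div_mul_eq_mul_div, le_div_iff₀ (by positivity)]
      gcongr
    linarith

lemma measurableSet_forall_le (n : ℕ) (c : ℝ) : MeasurableSet {y : Fin n → ℝ | ∀ i, c ≤ y i} :=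
  measurableSet_Ici (a := fun _ : Fin n => c)

lemma measurable_Z (M : BenchmarkModel) (n : ℕ) {h hb : ℝ} (hh : M.θ0 + h / n ∈ M.N)
    (hhb : M.θ0 + hb / n ∈ M.N) : Measurable (M.Z n h hb) := by
  have h1 : Measurable fun y : Fin n → ℝ =>
      ∏ i, M.f (y i) (M.θ0 + hb / n) / M.f (y i) (M.θ0 + h / n) :=
    Finset.measurable_prod _ fun i _ =>
      ((M.f_cont _ hhb).measurable.comp (measurable_pi_apply i)).div
        ((M.f_cont _ hh).measurable.comp (measurable_pi_apply i))
  exact Measurable.ite (measurableSet_forall_le n _)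
    ((Measurable.ite (measurableSet_forall_le n _) measurable_const measurable_const).mul h1)
    measurable_const

lemma abs_Z_sub_le (M : BenchmarkModel) (n : ℕ) {h hb : ℝ} (hh : M.θ0 + h / n ∈ M.N)
    (hhb : M.θ0 + hb / n ∈ M.N) (c : ℝ) {y : Fin n → ℝ}
    (hy : ∀ i, M.g (M.θ0 + h / n) ≤ y i) :
    |M.Z n h hb y - c ^ 2 * if ∀ i, M.g (M.θ0 + hb / n) ≤ y i then 1 else 0| ≤
      |M.sqrtLR n (M.θ0 + h / n) (M.θ0 + hb / n) y ^ 2 - c ^ 2| := by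
  rw [M.sqrtLR_sq n hh hhb, Z, if_pos hy]
  split_ifs
  · simp
  · simp

/-- Asymptotic joint survival function of the localized sample minimum. -/
lemma tendsto_integral_survival (M : BenchmarkModel) (h : ℝ) {k : ℕ} (hbar : Fin k → ℝ)
    (S : Finset (Fin k)) :
    Tendsto (fun n : ℕ => ∫ y, (if ∀ j ∈ S, ∀ i, M.g (M.θ0 + hbar j / n) ≤ y i then (1 : ℝ)
      else 0) ∂M.P n (M.θ0 + h / n)) atTop (𝓝 (exp ((h - S.fold max h hbar) / M.lam))) := by
  set H := S.fold max h hbar with hH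
  obtain ⟨a, b, ha, hb, hab, hg⟩ := M.exists_window
  have hmem : ∀ v : ℝ, ∀ᶠ n : ℕ in atTop, M.θ0 + v / n ∈ Set.Icc a b := fun v =>
    (tendsto_add_div_nat M.θ0 v).eventually (Icc_mem_nhds ha hb)
  have hlim := Real.tendsto_one_add_pow_exp_of_tendsto
    (M.tendsto_mul_setIntegral_Ici_sub_one H h)
  refine hlim.congr' ?_
  filter_upwards [hmem h, hmem H, eventually_all.2 fun j => hmem (hbar j),
    eventually_gt_atTop 0] with n hnh hnH hnj hn
  have hn' : (0 : ℝ) < n := by exact_mod_cast hn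
  have hmono : ∀ u v : ℝ, M.θ0 + u / n ∈ Set.Icc a b → M.θ0 + v / n ∈ Set.Icc a b → u ≤ v →
      M.g (M.θ0 + u / n) ≤ M.g (M.θ0 + v / n) := fun u v hu hv huv =>
    hg.monotoneOn hu hv (by gcongr)
  have hhH : h ≤ H := Finset.le_fold_max h |>.2 (Or.inl le_rfl)
  have hjH : ∀ j ∈ S, hbar j ≤ H := fun j hj =>
    Finset.le_fold_max _ |>.2 (Or.inr ⟨j, hj, le_rfl⟩)
  have hattained : H ≤ h ∨ ∃ j ∈ S, H ≤ hbar j := (Finset.le_fold_max H).1 le_rfl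
  have hiff : ∀ x, M.g (M.θ0 + h / n) ≤ x →
      ((∀ j ∈ S, M.g (M.θ0 + hbar j / n) ≤ x) ↔ M.g (M.θ0 + H / n) ≤ x) := by
    refine fun x hx => ⟨fun hall => ?_, fun hHx j hj =>
      (hmono _ _ (hnj j) hnH (hjH j hj)).trans hHx⟩
    rcases hattained with h1 | ⟨j, hj, h1⟩
    · exact (hmono _ _ hnH hnh h1).trans hx
    · exact (hmono _ _ hnH (hnj j) h1).trans (hall j hj)
  have hae : ∀ᵐ y ∂M.P n (M.θ0 + h / n),
      (if ∀ j ∈ S, ∀ i, M.g (M.θ0 + hbar j / n) ≤ y i then (1 : ℝ) else 0) =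
        ∏ i, (Set.Ici (M.g (M.θ0 + H / n))).indicator (fun _ => (1 : ℝ)) (y i) := by
    filter_upwards [M.ae_P n (hab hnh)] with y hy
    by_cases hc : ∀ i, M.g (M.θ0 + H / n) ≤ y i
    · rw [if_pos fun j hj i => (hiff _ (hy i)).2 (hc i) j hj, Finset.prod_eq_one fun i _ => ?_]
      exact Set.indicator_of_mem (hc i) _
    · rw [if_neg fun hall => hc fun i => (hiff _ (hy i)).1 fun j hj => hall j hj i]
      push Not at hc
      obtain ⟨i, hi⟩ := hc
      exact (Finset.prod_eq_zero (Finset.mem_univ i)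
        (Set.indicator_of_notMem (s := Set.Ici (M.g (M.θ0 + H / n))) hi.not_ge _)).symm
  rw [integral_congr_ae hae, M.integral_P_prod n (hab hnh), add_sub_cancel]
  congr 1
  have hsub : Set.Ici (M.g (M.θ0 + h / n)) ∩ Set.Ici (M.g (M.θ0 + H / n)) =
      Set.Ici (M.g (M.θ0 + H / n)) :=
    Set.inter_eq_right.2 (Set.Ici_subset_Ici.2 (hmono _ _ hnh hnH hhH))
  conv_lhs => rw [← hsub]
  rw [← setIntegral_indicator measurableSet_Ici]
  congr 1
  ext y
  simp [Set.indicator]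

/-- The limiting shifted exponential law. -/
def limitLaw (M : BenchmarkModel) (h : ℝ) : Measure ℝ :=
  volume.withDensity fun w =>
    ENNReal.ofReal ((M.lam)⁻¹ * exp (-(w - h) / M.lam) * if h < w then 1 else 0)

lemma limitLaw_eq (M : BenchmarkModel) (h : ℝ) :
    M.limitLaw h = (volume.restrict (Set.Ioi h)).withDensity fun w =>
      ENNReal.ofReal ((M.lam)⁻¹ * exp (-(w - h) / M.lam)) := by
  rw [limitLaw, ← withDensity_indicator measurableSet_Ioi]
  congr 1
  ext w
  by_cases hw : h < w <;> simp [Set.indicator, hw]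

lemma limit_density_eq (M : BenchmarkModel) (h w : ℝ) :
    (M.lam)⁻¹ * exp (-(w - h) / M.lam) =
      (M.lam)⁻¹ * exp (h / M.lam) * exp (-(M.lam)⁻¹ * w) := by
  rw [mul_assoc, ← Real.exp_add]
  congr 2
  ring

lemma integrableOn_limit_density (M : BenchmarkModel) (h H : ℝ) :
    IntegrableOn (fun w => (M.lam)⁻¹ * exp (-(w - h) / M.lam)) (Set.Ioi H) := by
  simp_rw [M.limit_density_eq]
  exact (exp_neg_integrableOn_Ioi H (inv_pos.2 M.lam_pos)).const_mul _

lemma setIntegral_limit_density (M : BenchmarkModel) (h H : ℝ) :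
    ∫ w in Set.Ioi H, (M.lam)⁻¹ * exp (-(w - h) / M.lam) = exp ((h - H) / M.lam) := by
  have hl := inv_pos.2 M.lam_pos
  simp_rw [M.limit_density_eq]
  rw [integral_const_mul, integral_exp_mul_Ioi (neg_lt_zero.2 hl)]
  rw [show (h - H) / M.lam = h / M.lam + -(M.lam)⁻¹ * H by ring, Real.exp_add]
  have := M.lam_pos.ne'
  field_simp

lemma isProbabilityMeasure_limitLaw (M : BenchmarkModel) (h : ℝ) :
    IsProbabilityMeasure (M.limitLaw h) := by
  have := M.lam_pos
  refine ⟨?_⟩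
  rw [limitLaw_eq, withDensity_apply _ MeasurableSet.univ, Measure.restrict_univ,
    ← ofReal_integral_eq_lintegral_ofReal (M.integrableOn_limit_density h h)
      (Eventually.of_forall fun y => by positivity), setIntegral_limit_density]
  simp

lemma integral_survival_limitLaw (M : BenchmarkModel) (h : ℝ) {k : ℕ} (hbar : Fin k → ℝ)
    (S : Finset (Fin k)) :
    ∫ w, (if ∀ j ∈ S, hbar j < w then (1 : ℝ) else 0) ∂M.limitLaw h =
      exp ((h - S.fold max h hbar) / M.lam) := by
  set H := S.fold max h hbar with hH
  have hl := M.lam_pos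
  have hset : Set.Ioi h ∩ {w | ∀ j ∈ S, hbar j < w} = Set.Ioi H := by
    ext w
    simp [hH, Finset.fold_max_lt]
  have hmeas : MeasurableSet {w : ℝ | ∀ j ∈ S, hbar j < w} := by
    have : {w : ℝ | ∀ j ∈ S, hbar j < w} = ⋂ j ∈ S, Set.Ioi (hbar j) := by
      ext w
      simp
    rw [this]
    exact S.measurableSet_biInter fun j _ => measurableSet_Ioi
  rw [limitLaw_eq, integral_withDensity_eq_integral_toReal_smul (by fun_prop) (by simp),
    ← M.setIntegral_limit_density h H, ← hset, ← setIntegral_indicator hmeas]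
  congr 1
  ext w
  have : 0 ≤ (M.lam)⁻¹ * exp (-(w - h) / M.lam) := by positivity
  rw [ENNReal.toReal_ofReal this]
  simp [Set.indicator]

lemma integrable_ite_one {α : Type*} [MeasurableSpace α] {μ : Measure α} [IsFiniteMeasure μ]
    {p : α → Prop} {_ : DecidablePred p} (hp : MeasurableSet {x | p x}) :
    Integrable (fun x => if p x then (1 : ℝ) else 0) μ := by
  refine Integrable.of_bound (C := 1)
    (Measurable.ite hp measurable_const measurable_const).aestronglyMeasurable
    (Eventually.of_forall fun x => ?_)
  split_ifs <;> simp

/-- Joint weak convergence of the boundary indicators. -/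
lemma tendsto_integral_indicators (M : BenchmarkModel) (h : ℝ) {k : ℕ} (hbar : Fin k → ℝ)
    (φ : Set (Fin k) → ℝ) :
    Tendsto (fun n : ℕ => ∫ y, φ {j | ∀ i, M.g (M.θ0 + hbar j / n) ≤ y i}
      ∂M.P n (M.θ0 + h / n)) atTop (𝓝 (∫ w, φ {j | hbar j < w} ∂M.limitLaw h)) := by
  obtain ⟨ψ, hψ⟩ := exists_sum_ite_eq φ
  have := M.isProbabilityMeasure_limitLaw h
  have hmeas : ∀ S : Finset (Fin k), MeasurableSet {w : ℝ | ∀ j ∈ S, hbar j < w} := fun S => by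
    simp only [Set.ofPred_forall]
    exact S.measurableSet_biInter fun j _ => measurableSet_Ioi
  have hlim : ∫ w, φ {j | hbar j < w} ∂M.limitLaw h =
      ∑ S : Finset (Fin k), ψ S * exp ((h - S.fold max h hbar) / M.lam) := by
    simp_rw [hψ]
    rw [integral_finsetSum]
    · refine Finset.sum_congr rfl fun S _ => ?_
      rw [integral_const_mul, ← M.integral_survival_limitLaw h hbar S]
      congr!
    · exact fun S _ => Integrable.const_mul (integrable_ite_one (hmeas S)) _
  rw [hlim]
  refine (tendsto_finsetSum _ fun S _ =>
    (M.tendsto_integral_survival h hbar S).const_mul (ψ S)).congr' ?_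
  filter_upwards [M.eventually_mem_N h] with n hn
  have := M.isProbabilityMeasure_P n hn
  have hmeas' : ∀ S : Finset (Fin k), MeasurableSet
      {y : Fin n → ℝ | ∀ j ∈ S, ∀ i, M.g (M.θ0 + hbar j / n) ≤ y i} := fun S => by
    rw [Set.ofPred_forall]
    refine MeasurableSet.iInter fun j => ?_
    rw [Set.ofPred_forall]
    exact MeasurableSet.iInter fun _ => measurableSet_forall_le n _
  simp_rw [hψ]
  rw [integral_finsetSum]
  · refine Finset.sum_congr rfl fun S _ => ?_
    rw [integral_const_mul]
    congr!
  · exact fun S _ => Integrable.const_mul (integrable_ite_one (hmeas' S)) _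

/-- The likelihood ratios may be replaced by constants times boundary indicators. -/
lemma tendsto_integral_sub (M : BenchmarkModel) (h : ℝ) {k : ℕ} (hbar : Fin k → ℝ)
    (F : BoundedContinuousFunction (Fin k → ℝ) ℝ) :
    Tendsto (fun n : ℕ => (∫ y, F (fun j => M.Z n h (hbar j) y) ∂M.P n (M.θ0 + h / n)) -
      ∫ y, F (fun j => exp ((hbar j - h) / M.lam) *
        if ∀ i, M.g (M.θ0 + hbar j / n) ≤ y i then 1 else 0) ∂M.P n (M.θ0 + h / n))
      atTop (𝓝 0) := by
  set c : Fin k → ℝ := fun j => exp ((hbar j - h) / M.lam / 2) with hc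
  have hc2 : ∀ j, exp ((hbar j - h) / M.lam) = c j ^ 2 := fun j => by
    rw [hc, ← Real.exp_nat_mul]
    congr 1
    push_cast
    ring
  simp_rw [hc2]
  set K : Set (Fin k → ℝ) := Set.univ.pi fun j => {0, c j ^ 2} with hK
  have hKc : IsCompact K := isCompact_univ_pi fun j => (Set.toFinite _).isCompact
  refine Metric.tendsto_nhds.2 fun ε hε => ?_
  obtain ⟨R, hR, hF⟩ := exists_abs_sub_le F hKc c (half_pos hε)
  have hsum : Tendsto (fun n : ℕ => R * ∑ j, ∫ y, (M.sqrtLR n (M.θ0 + h / n)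
      (M.θ0 + hbar j / n) y - c j) ^ 2 ∂M.P n (M.θ0 + h / n)) atTop (𝓝 0) := by
    have := (tendsto_finsetSum Finset.univ fun j _ =>
      M.tendsto_integral_sqrtLR_sub_sq h (hbar j)).const_mul R
    simpa using this
  filter_upwards [hsum.eventually (gt_mem_nhds (half_pos hε)), M.eventually_mem_N h,
    eventually_all.2 fun j => M.eventually_mem_N (hbar j)] with n hn hnh hnj
  have := M.isProbabilityMeasure_P n hnh
  have hFint : ∀ V : (Fin n → ℝ) → Fin k → ℝ, Measurable V →
      Integrable (fun y => F (V y)) (M.P n (M.θ0 + h / n)) := fun V hV =>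
    Integrable.of_bound (F.continuous.measurable.comp hV).aestronglyMeasurable ‖F‖
      (Eventually.of_forall fun y => F.norm_coe_le_norm _)
  have hZ := hFint _ (measurable_pi_lambda _ fun j => M.measurable_Z n hnh (hnj j))
  have hV := hFint (fun y j => c j ^ 2 *
    if ∀ i, M.g (M.θ0 + hbar j / n) ≤ y i then 1 else 0) (measurable_pi_lambda _ fun j =>
      (Measurable.ite (measurableSet_forall_le n _) measurable_const measurable_const).const_mul _)
  have hX : ∀ j, Integrable (fun y => (M.sqrtLR n (M.θ0 + h / n)
      (M.θ0 + hbar j / n) y - c j) ^ 2) (M.P n (M.θ0 + h / n)) := fun j => by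
    have := ((M.integrable_sqrtLR_sq n hnh (hnj j)).sub
      ((M.integrable_sqrtLR n hnh (hnj j)).const_mul (2 * c j))).add (integrable_const (c j ^ 2))
    refine this.congr (Eventually.of_forall fun y => ?_)
    simp only [Pi.add_apply, Pi.sub_apply]
    ring
  have hsumint := (integrable_finsetSum Finset.univ fun j _ => hX j).const_mul R
  rw [dist_zero_right, ← integral_sub hZ hV]
  calc _ ≤ ∫ y, (ε / 2 + R * ∑ j, (M.sqrtLR n (M.θ0 + h / n)
        (M.θ0 + hbar j / n) y - c j) ^ 2) ∂M.P n (M.θ0 + h / n) := by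
        refine norm_integral_le_of_norm_le ((integrable_const _).add hsumint) ?_
        filter_upwards [M.ae_P n hnh] with y hy
        refine hF _ (fun j _ => ?_) _ _ fun j => M.abs_Z_sub_le n hnh (hnj j) (c j) hy
        by_cases hj : ∀ i, M.g (M.θ0 + hbar j / n) ≤ y i <;> simp [hj]
    _ = ε / 2 + R * ∑ j, ∫ y, (M.sqrtLR n (M.θ0 + h / n)
        (M.θ0 + hbar j / n) y - c j) ^ 2 ∂M.P n (M.θ0 + h / n) := by
        rw [integral_add (integrable_const _) hsumint, integral_const_mul,
          integral_finsetSum _ fun j _ => hX j]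
        simp
    _ < ε := by linarith

/-- Weak convergence of the likelihood-ratio process: for every `h` and every finite
collection `h̄_1, …, h̄_k`, the law of `(Z_n(h,h̄_1), …, Z_n(h,h̄_k))` under
`P^n_{θ0+h/n}` converges weakly to the law of
`(e^{(h̄_j−h)/λ}·𝟙{W > h̄_j})_{j≤k}` where `W` has density
`w ↦ λ⁻¹ e^{−(w−h)/λ} 𝟙{w > h}`. -/
theorem weak_convergence_LR_process (M : BenchmarkModel) (h : ℝ) (k : ℕ) (hbar : Fin k → ℝ)
    (F : BoundedContinuousFunction (Fin k → ℝ) ℝ) :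
    Tendsto
      (fun n : ℕ => ∫ y, F (fun j => M.Z n h (hbar j) y) ∂ M.P n (M.θ0 + h / n))
      atTop
      (𝓝 (∫ w, F (fun j => exp ((hbar j - h) / M.lam) * if hbar j < w then 1 else 0)
        ∂ ((volume : Measure ℝ).withDensity fun w =>
            ENNReal.ofReal ((M.lam)⁻¹ * exp (-(w - h) / M.lam) * if h < w then 1 else 0)))) := by
  have h1 := M.tendsto_integral_indicators h hbar
    fun A => F fun j => exp ((hbar j - h) / M.lam) * if j ∈ A then 1 else 0
  have h2 := h1.add (M.tendsto_integral_sub h hbar F)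
  simp only [Set.mem_ofPred_eq, add_zero] at h2
  change Tendsto _ _ (𝓝 (∫ w, _ ∂M.limitLaw h))
  convert h2 using 2 with n
  · symm
    convert add_sub_cancel _ _

end BenchmarkModel
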